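/- For every ρ > 0 and every integer n ≥ 2, the Moser function w̄_n satisfies ∫_{ℝ²} w̄_n(x)² dx = ρ² ( 1/(4 log n) − 1/(4 n² log n) − 1/(2 n²) ). -/

import Mathlib

open MeasureTheory Real

/-- The Moser function `w̄_n` on `ℝ²`, supported in the ball of radius `ρ`. -/
noncomputable def moserFn (ρ : ℝ) (n : ℕ) (x : EuclideanSpace ℝ (Fin 2)) : ℝ :=
  if ‖x‖ ≤ ρ / n then Real.sqrt (Real.log n) / Real.sqrt (2 * Real.pi)
  else if ‖x‖ ≤ ρ then
    (Real.log (ρ / ‖x‖) / Real.sqrt (Real.log n)) / Real.sqrt (2 * Real.pi)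
  else 0

/-- The `L²` norm squared of the Moser function. -/
theorem stmt_6 (ρ : ℝ) (hρ : 0 < ρ) (n : ℕ) (hn : 2 ≤ n) :
    ∫ x, (moserFn ρ n x) ^ 2 =
      ρ ^ 2 * (1 / (4 * Real.log n) - 1 / (4 * n ^ 2 * Real.log n)
        - 1 / (2 * n ^ 2)) := by
  have hn1 : (1 : ℝ) < n := by exact_mod_cast (by omega : 1 < n)
  have hn0 : (0 : ℝ) < n := by linarith
  have hL : 0 < Real.log n := Real.log_pos hn1
  have ha : 0 < ρ / n := by positivity
  have haρ : ρ / n ≤ ρ := div_le_self hρ.le hn1.le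
  have key := integral_fun_norm_addHaar (volume : Measure (EuclideanSpace ℝ (Fin 2)))
    (fun r : ℝ => (if r ≤ ρ / n then Real.sqrt (Real.log n) / Real.sqrt (2 * Real.pi)
      else if r ≤ ρ then
        (Real.log (ρ / r) / Real.sqrt (Real.log n)) / Real.sqrt (2 * Real.pi)
      else 0) ^ 2)
  have hv : (volume : Measure (EuclideanSpace ℝ (Fin 2))).real (Metric.ball 0 1) = π := by
    simp [Measure.real, EuclideanSpace.volume_ball_fin_two, Real.pi_pos.le]
  unfold moserFn
  rw [key, hv]
  have hfun : Set.EqOn (fun r : ℝ => r ^ (Module.finrank ℝ (EuclideanSpace ℝ (Fin 2)) - 1) •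
      (if r ≤ ρ / n then Real.sqrt (Real.log n) / Real.sqrt (2 * Real.pi)
      else if r ≤ ρ then
        (Real.log (ρ / r) / Real.sqrt (Real.log n)) / Real.sqrt (2 * Real.pi)
      else 0) ^ 2)
      (fun r => (Set.Ioc 0 (ρ / n)).indicator (fun r => (Real.log n / (2 * π)) * r) r
        + (Set.Ioc (ρ / n) ρ).indicator
          (fun r => (1 / (Real.log n * (2 * π))) * (r * Real.log (ρ / r) ^ 2)) r)
      (Set.Ioi 0) := by
    intro r hr
    have hr' : 0 < r := hr
    have h2 : Real.sqrt (2 * π) ^ 2 = 2 * π := Real.sq_sqrt (by positivity)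
    have h3 : Real.sqrt (Real.log n) ^ 2 = Real.log n := Real.sq_sqrt hL.le
    have hd : Module.finrank ℝ (EuclideanSpace ℝ (Fin 2)) - 1 = 1 := by simp
    simp only [hd, pow_one, smul_eq_mul, Set.indicator, Set.mem_Ioc]
    by_cases h1 : r ≤ ρ / n
    · simp only [h1, hr', not_lt.mpr h1, true_and, false_and, if_true, if_false, and_self]
      rw [div_pow, h2, h3]; ring
    · by_cases h4 : r ≤ ρ
      · simp only [h1, h4, not_le.mp h1, and_true, and_false, if_true, if_false]
        rw [div_pow, div_pow, h2, h3]
        field_simp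
        ring
      · simp [h1, h4]
  have hderiv : ∀ r ∈ Set.uIcc (ρ / n) ρ, HasDerivAt
      (fun r : ℝ => r ^ 2 / 2 * (Real.log (ρ / r) ^ 2 + Real.log (ρ / r) + 1 / 2))
      (r * Real.log (ρ / r) ^ 2) r := by
    intro r hr
    rw [Set.uIcc_of_le haρ] at hr
    have hr0 : r ≠ 0 := (ha.trans_le hr.1).ne'
    have hl : HasDerivAt (fun r : ℝ => Real.log (ρ / r)) (-(1 / r)) r := by
      have h := ((hasDerivAt_const r ρ).div (hasDerivAt_id r) hr0).log
        (by simp; exact ⟨hρ.ne', hr0⟩)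
      refine h.congr_deriv ?_
      simp
      field_simp
    have h := (((hasDerivAt_id r).pow 2).div_const 2).mul (((hl.pow 2).add hl).add_const (1 / 2))
    refine h.congr_deriv ?_
    simp
    field_simp
    ring
  have hcont : ContinuousOn (fun r : ℝ => r * Real.log (ρ / r) ^ 2) (Set.uIcc (ρ / n) ρ) := by
    rw [Set.uIcc_of_le haρ]
    have hne : ∀ r ∈ Set.Icc (ρ / n) ρ, r ≠ 0 := fun r hr => (ha.trans_le hr.1).ne'
    refine continuousOn_id.mul (ContinuousOn.pow (ContinuousOn.log
      (continuousOn_const.div continuousOn_id hne) ?_) 2)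
    intro r hr
    exact div_ne_zero hρ.ne' (hne r hr)
  have hint := hcont.intervalIntegrable (μ := volume)
  have hI2 := intervalIntegral.integral_eq_sub_of_hasDerivAt hderiv hint
  have hs1 : Set.Ioi (0 : ℝ) ∩ Set.Ioc 0 (ρ / n) = Set.Ioc 0 (ρ / n) :=
    Set.inter_eq_right.mpr fun r hr => hr.1
  have hs2 : Set.Ioi (0 : ℝ) ∩ Set.Ioc (ρ / n) ρ = Set.Ioc (ρ / n) ρ :=
    Set.inter_eq_right.mpr fun r hr => ha.trans hr.1
  have hi1 : IntegrableOn (fun r => (Real.log n / (2 * π)) * r) (Set.Ioc 0 (ρ / n)) :=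
    (Continuous.integrableOn_Icc (by fun_prop)).mono_set Set.Ioc_subset_Icc_self
  have hi2 : IntegrableOn (fun r => (1 / (Real.log n * (2 * π))) * (r * Real.log (ρ / r) ^ 2))
      (Set.Ioc (ρ / n) ρ) :=
    ((intervalIntegrable_iff_integrableOn_Ioc_of_le haρ).mp hint).const_mul _
  rw [setIntegral_congr_fun measurableSet_Ioi hfun, integral_add
    ((integrable_indicator_iff measurableSet_Ioc).mpr hi1).integrableOn
    ((integrable_indicator_iff measurableSet_Ioc).mpr hi2).integrableOn,
    setIntegral_indicator measurableSet_Ioc, setIntegral_indicator measurableSet_Ioc, hs1, hs2,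
    ← intervalIntegral.integral_of_le ha.le, ← intervalIntegral.integral_of_le haρ,
    intervalIntegral.integral_const_mul, intervalIntegral.integral_const_mul, hI2, integral_id]
  have e1 : ρ / (ρ / n) = n := by field_simp
  have e2 : ρ / ρ = 1 := div_self hρ.ne'
  rw [e1, e2, Real.log_one]
  simp only [finrank_euclideanSpace, Fintype.card_fin, nsmul_eq_mul, smul_eq_mul]
  have hL' := hL.ne'
  have hpi := Real.pi_ne_zero
  push_cast
  field_simp
  ring
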